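/- arXiv:2407.18127 — 11 statements merged into one kernel-verified Lean document; each statement's English description precedes it below -/
import Mathlib

section
/- Let m ≥ 0 and let x ≥ 1 + log₂(m+2) (so in particular x ≥ 2). Then for all real numbers t, k with 0 < t ≤ k ≤ 1, one has (1+t)^x ≥ 1 + ( ((1+k)^x − 1)/k^x + k^x − t^x ) · t^x + m·x·(1/t − 1/k)·t^x. -/
lemma aux_conv (y t : ℝ) (hy : 1 ≤ y) (ht : 0 < t) (h1 : t ≤ 1) :
    1 + 2 ^ y * t ^ y ≤ t ^ y + (1 + t) ^ y := by
  have c := (convexOn_rpow hy).2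
  have a := c (x := t) (y := 1 + t) (by simp; linarith) (by simp; linarith) (a := t) (b := 1 - t)
    ht.le (by linarith) (by ring)
  have b := c (x := t) (y := 1 + t) (by simp; linarith) (by simp; linarith) (a := 1 - t) (b := t)
    (by linarith) ht.le (by ring)
  simp only [smul_eq_mul] at a b
  rw [show t * t + (1 - t) * (1 + t) = 1 by ring, Real.one_rpow] at a
  rw [show (1 - t) * t + t * (1 + t) = 2 * t by ring, Real.mul_rpow (by norm_num) ht.le] at b
  linarith

lemma aux_key (m x t : ℝ) (hm : 0 ≤ m) (hx : 1 + Real.logb 2 (m + 2) ≤ x)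
    (ht : 0 < t) (h1 : t ≤ 1) :
    1 + t ^ (2 * x) + m * t ^ (x - 1) ≤ (1 + t) ^ (x - 1) := by
  have h2 : 1 ≤ Real.logb 2 (m + 2) := by
    rw [Real.le_logb_iff_rpow_le (by norm_num) (by linarith)]
    simpa using hm
  have h3 : m + 2 ≤ 2 ^ (x - 1) := by
    rw [← Real.logb_le_iff_le_rpow (by norm_num) (by linarith)]
    linarith
  have h4 := aux_conv (x - 1) t (by linarith) ht h1
  have h5 : t ^ (2 * x) ≤ t ^ (x - 1) :=
    Real.rpow_le_rpow_of_exponent_ge ht h1 (by linarith)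
  have h6 := mul_le_mul_of_nonneg_right h3 (Real.rpow_pos_of_pos ht (x - 1)).le
  linarith

/-- Lemma 2.1(i): parametrized lower bound for `(1+t)^x` when `0 < t ≤ k ≤ 1`. -/
theorem parametrized_bound_case1 (m x t k : ℝ) (hm : 0 ≤ m)
    (hx : 1 + Real.logb 2 (m + 2) ≤ x)
    (ht : 0 < t) (htk : t ≤ k) (hk : k ≤ 1) :
    (1 + t) ^ x ≥
      1 + (((1 + k) ^ x - 1) / k ^ x + k ^ x - t ^ x) * t ^ x
        + m * x * (1 / t - 1 / k) * t ^ x := by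
  have hx0 : 0 ≤ x := by
    have : 0 ≤ Real.logb 2 (m + 2) := Real.logb_nonneg (by norm_num) (by linarith)
    linarith
  have hd : ∀ s : ℝ, 0 < s → HasDerivAt
      (fun s : ℝ => ((1 + s) ^ x - 1) * s ^ (-x) + s ^ x - m * x * s⁻¹)
      (((1 * x * (1 + s) ^ (x - 1)) * s ^ (-x) + ((1 + s) ^ x - 1) * (1 * (-x) * s ^ (-x - 1)))
        + 1 * x * s ^ (x - 1) - m * x * (-(s ^ 2)⁻¹)) s := by
    intro s hs
    have e1 := (((hasDerivAt_id s).const_add 1).rpow_const (p := x)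
      (Or.inl (by simp; linarith))).sub_const 1
    have e2 := (hasDerivAt_id s).rpow_const (p := -x) (Or.inl hs.ne')
    have e3 := (hasDerivAt_id s).rpow_const (p := x) (Or.inl hs.ne')
    exact ((e1.mul e2).add e3).sub ((hasDerivAt_inv hs.ne').const_mul (m * x))
  have hanti : AntitoneOn
      (fun s : ℝ => ((1 + s) ^ x - 1) * s ^ (-x) + s ^ x - m * x * s⁻¹) (Set.Icc t k) := by
    apply antitoneOn_of_deriv_nonpos (convex_Icc t k)
    · intro s hs
      exact (hd s (ht.trans_le hs.1)).continuousAt.continuousWithinAt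
    · intro s hs
      rw [interior_Icc] at hs
      exact (hd s (ht.trans hs.1)).differentiableAt.differentiableWithinAt
    · intro s hs
      rw [interior_Icc] at hs
      have hs0 : 0 < s := ht.trans hs.1
      rw [(hd s hs0).deriv]
      have key := aux_key m x s hm hx hs0 (hs.2.le.trans hk)
      have p := (Real.rpow_pos_of_pos hs0 (-x - 1))
      have q1 : s ^ (-x) = s * s ^ (-x - 1) := by
        rw [Real.rpow_sub_one hs0.ne']; field_simp
      have q2 : s ^ (x - 1) = s ^ (2 * x) * s ^ (-x - 1) := by
        rw [← Real.rpow_add hs0]; congr 1; ring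
      have q3 : (s ^ 2)⁻¹ = s ^ (x - 1) * s ^ (-x - 1) := by
        rw [← Real.rpow_add hs0, ← Real.rpow_natCast, ← Real.rpow_neg hs0.le]
        congr 1; push_cast; ring
      have q4 : (1 + s) ^ x = (1 + s) * (1 + s) ^ (x - 1) := by
        rw [Real.rpow_sub_one (by linarith)]; field_simp
      have : ((1 * x * (1 + s) ^ (x - 1)) * s ^ (-x)
          + ((1 + s) ^ x - 1) * (1 * (-x) * s ^ (-x - 1)))
          + 1 * x * s ^ (x - 1) - m * x * (-(s ^ 2)⁻¹)
          = x * s ^ (-x - 1) *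
            (1 + s ^ (2 * x) + m * s ^ (x - 1) - (1 + s) ^ (x - 1)) := by
        rw [q3, q4, q1]
        linear_combination x * q2
      rw [this]
      exact mul_nonpos_of_nonneg_of_nonpos (by positivity) (by linarith)
  have h := hanti (Set.left_mem_Icc.2 htk) (Set.right_mem_Icc.2 htk) htk
  simp only at h
  have T := Real.rpow_pos_of_pos ht x
  have h' := mul_le_mul_of_nonneg_right h T.le
  rw [Real.rpow_neg ht.le, Real.rpow_neg (ht.le.trans htk)] at h'
  have c : ((1 + t) ^ x - 1) * (t ^ x)⁻¹ * t ^ x = (1 + t) ^ x - 1 := by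
    field_simp
  rw [one_div, one_div, div_eq_mul_inv]
  linear_combination h' + c
end

section
/- Let m ≥ 0 and let x ≥ 1 + log₂(m+2) (so in particular x ≥ 2). Then for all real numbers t, k with t ≥ k ≥ 1, one has (1+t)^x ≥ t^x + (1+k)^x − k^x + k^(−x) − t^(−x) + m·x·(t − k). -/
theorem aux_convex (y t : ℝ) (hy : 1 ≤ y) (ht : 1 ≤ t) :
    (2:ℝ) ^ y + t ^ y ≤ 1 + (1 + t) ^ y := by
  have hc := convexOn_rpow hy
  have ht0 : (0:ℝ) < t := by linarith
  have h1 : (0:ℝ) ≤ 1 / t := by positivity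
  have h2 : (0:ℝ) ≤ 1 - 1 / t := by
    rw [sub_nonneg, div_le_one ht0]; exact ht
  have m1 : (1:ℝ) ∈ Set.Ici (0:ℝ) := by simp
  have m2 : (1 + t:ℝ) ∈ Set.Ici (0:ℝ) := by
    simp only [Set.mem_Ici]; linarith
  have a := hc.2 m1 m2 h2 h1 (by ring)
  have b := hc.2 m1 m2 h1 h2 (by ring)
  simp only [smul_eq_mul, Real.one_rpow] at a b
  have e1 : (1 - 1 / t) * 1 + 1 / t * (1 + t) = 2 := by field_simp; ring
  have e2 : 1 / t * 1 + (1 - 1 / t) * (1 + t) = t := by field_simp; ring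
  rw [e1] at a
  rw [e2] at b
  linarith

/-- Lemma 2.1(ii): parametrized lower bound for `(1+t)^x` when `t ≥ k ≥ 1`. -/
theorem parametrized_bound_case2 (m x t k : ℝ) (hm : 0 ≤ m)
    (hx : 1 + Real.logb 2 (m + 2) ≤ x)
    (hk : 1 ≤ k) (htk : k ≤ t) :
    (1 + t) ^ x ≥
      t ^ x + (1 + k) ^ x - k ^ x + k ^ (-x) - t ^ (-x) + m * x * (t - k) := by
  have hm2 : m + 2 ≤ (2:ℝ) ^ (x - 1) := by
    rw [← Real.logb_le_iff_le_rpow (by norm_num) (by linarith)]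
    linarith
  have hx2 : 2 ≤ x := by
    have : (1:ℝ) ≤ Real.logb 2 (m + 2) := by
      rw [Real.le_logb_iff_rpow_le (by norm_num) (by linarith), Real.rpow_one]
      linarith
    linarith
  have hd : ∀ s : ℝ, 1 ≤ s → HasDerivAt
      (fun s : ℝ => (1 + s) ^ x - s ^ x + s ^ (-x) - m * x * s)
      (1 * x * (1 + s) ^ (x - 1) - 1 * x * s ^ (x - 1) + 1 * (-x) * s ^ (-x - 1) - m * x * 1) s := by
    intro s hs
    have i := hasDerivAt_id' s
    have h0 : s ≠ 0 := by linarith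
    have h1 : 1 + s ≠ 0 := by linarith
    exact ((((i.const_add 1).rpow_const (Or.inl h1)).sub (i.rpow_const (Or.inl h0))).add
      (i.rpow_const (Or.inl h0))).sub (i.const_mul (m * x))
  have hmono : MonotoneOn (fun s : ℝ => (1 + s) ^ x - s ^ x + s ^ (-x) - m * x * s)
      (Set.Ici 1) := by
    apply monotoneOn_of_deriv_nonneg (convex_Ici 1)
    · intro s hs
      exact (hd s hs).continuousAt.continuousWithinAt
    · intro s hs
      rw [interior_Ici] at hs
      exact (hd s (le_of_lt hs)).differentiableAt.differentiableWithinAt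
    · intro s hs
      rw [interior_Ici] at hs
      have hs1 : 1 ≤ s := le_of_lt hs
      rw [(hd s hs1).deriv]
      have a := aux_convex (x - 1) s (by linarith) hs1
      have b : s ^ (-x - 1) ≤ 1 := Real.rpow_le_one_of_one_le_of_nonpos hs1 (by linarith)
      have c : 0 ≤ (1 + s) ^ (x - 1) - s ^ (x - 1) - s ^ (-x - 1) - m := by linarith
      have d := mul_nonneg (by linarith : (0:ℝ) ≤ x) c
      linarith
  have h := hmono (Set.mem_Ici.2 hk) (Set.mem_Ici.2 (hk.trans htk)) htk
  simp only at h
  linarith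
end

section
/- Let m ≥ 0 and let x ≥ 1 + log₂(m+2) (so in particular x ≥ 2). Then for all real t with 0 < t ≤ 1, one has (1+t)^x ≥ 1 + (2^x − t^x)·t^x + m·x·(1/t − 1)·t^x. -/
lemma aux_incr (y s : ℝ) (hy : 1 ≤ y) (hs : 1 ≤ s) :
    (2 : ℝ) ^ y + s ^ y ≤ 1 + (1 + s) ^ y := by
  have hc := convexOn_rpow hy
  have hs0 : 0 < s := by linarith
  have h1 : 0 ≤ 1 - 1 / s := by
    rw [sub_nonneg, div_le_one hs0]; exact hs
  have h2 : 0 ≤ 1 / s := by positivity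
  have m1 : (1 : ℝ) ∈ Set.Ici (0 : ℝ) := by simp
  have m2 : (1 + s : ℝ) ∈ Set.Ici (0 : ℝ) := by simp; linarith
  have a := hc.2 m1 m2 h1 h2 (by ring)
  have b := hc.2 m1 m2 h2 h1 (by ring)
  simp only [smul_eq_mul, Real.one_rpow] at a b
  have e1 : (1 - 1 / s) * 1 + 1 / s * (1 + s) = 2 := by field_simp; ring
  have e2 : 1 / s * 1 + (1 - 1 / s) * (1 + s) = s := by field_simp; ring
  rw [e1] at a
  rw [e2] at b
  linarith

lemma aux_main (m x s : ℝ) (hx2 : 2 ≤ x) (hm2 : m + 2 ≤ (2 : ℝ) ^ (x - 1)) (hs : 1 ≤ s) :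
    (2 : ℝ) ^ x + m * x * (s - 1) ≤ (1 + s) ^ x - s ^ x + s ^ (-x) := by
  let g : ℝ → ℝ := fun s => (1 + s) ^ x - s ^ x + s ^ (-x) - m * x * (s - 1)
  have hd : ∀ u : ℝ, 1 ≤ u → HasDerivAt g
      (x * (1 + u) ^ (x - 1) - x * u ^ (x - 1) + (-x) * u ^ (-x - 1) - m * x) u := by
    intro u hu
    have a1 : HasDerivAt (fun s : ℝ => 1 + s) 1 u := (hasDerivAt_id u).const_add 1
    have a := a1.rpow_const (p := x) (Or.inl (by linarith))
    have b := Real.hasDerivAt_rpow_const (x := u) (p := x) (Or.inl (by linarith))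
    have c := Real.hasDerivAt_rpow_const (x := u) (p := -x) (Or.inl (by linarith))
    have d := ((hasDerivAt_id u).sub_const 1).const_mul (m * x)
    exact (((a.sub b).add c).sub d).congr_deriv (by ring)
  have hmono : MonotoneOn g (Set.Ici 1) := by
    apply monotoneOn_of_deriv_nonneg (convex_Ici 1)
    · intro u hu
      exact (hd u hu).continuousAt.continuousWithinAt
    · intro u hu
      rw [interior_Ici] at hu
      exact (hd u (le_of_lt hu)).differentiableAt.differentiableWithinAt
    · intro u hu
      rw [interior_Ici] at hu
      have hu1 : 1 ≤ u := le_of_lt hu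
      rw [(hd u hu1).deriv]
      have h1 := aux_incr (x - 1) u (by linarith) hu1
      have h2 : u ^ (-x - 1) ≤ 1 := Real.rpow_le_one_of_one_le_of_nonpos hu1 (by linarith)
      have : 0 ≤ x * ((1 + u) ^ (x - 1) - u ^ (x - 1) - u ^ (-x - 1) - m) :=
        mul_nonneg (by linarith) (by linarith)
      linarith
  have h := hmono (Set.mem_Ici.2 le_rfl) (Set.mem_Ici.2 hs) hs
  simp only [g, Real.one_rpow] at h
  norm_num at h
  linarith

/-- Corollary 2.2(i): the `k = 1` case of the parametrized bound, for `0 < t ≤ 1`. -/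
theorem parametrized_bound_case1_k_one (m x t : ℝ) (hm : 0 ≤ m)
    (hx : 1 + Real.logb 2 (m + 2) ≤ x)
    (ht : 0 < t) (ht1 : t ≤ 1) :
    (1 + t) ^ x ≥
      1 + ((2 : ℝ) ^ x - t ^ x) * t ^ x + m * x * (1 / t - 1) * t ^ x := by
  have hm2 : m + 2 ≤ (2 : ℝ) ^ (x - 1) := by
    rw [← Real.logb_le_iff_le_rpow (by norm_num) (by linarith)]
    linarith
  have hx2 : 2 ≤ x := by
    have : (1 : ℝ) ≤ Real.logb 2 (m + 2) := by
      rw [Real.le_logb_iff_rpow_le (by norm_num) (by linarith)]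
      norm_num
      exact hm
    linarith
  have hs : 1 ≤ 1 / t := by rw [le_div_iff₀ ht]; linarith
  have h := aux_main m x (1 / t) hx2 hm2 hs
  have hp : 0 < t ^ x := Real.rpow_pos_of_pos ht x
  have e1 : (1 + 1 / t) ^ x * t ^ x = (1 + t) ^ x := by
    rw [← Real.mul_rpow (by positivity) ht.le]
    congr 1
    field_simp
    ring
  have e2 : (1 / t) ^ x * t ^ x = 1 := by
    rw [← Real.mul_rpow (by positivity) ht.le, one_div_mul_cancel ht.ne', Real.one_rpow]
  have e3 : (1 / t) ^ (-x) = t ^ x := by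
    rw [one_div, Real.inv_rpow ht.le, Real.rpow_neg ht.le, inv_inv]
  rw [e3] at h
  have h' := mul_le_mul_of_nonneg_right h hp.le
  have e4 : ((1 + 1 / t) ^ x - (1 / t) ^ x + t ^ x) * t ^ x
      = (1 + t) ^ x - 1 + t ^ x * t ^ x := by
    rw [add_mul, sub_mul, e1, e2]
  rw [e4] at h'
  linarith
end

section
/- Let m ≥ 0 and let x ≥ 1 + log₂(m+2) (so in particular x ≥ 2). Then for all real t with t ≥ 1, one has (1+t)^x ≥ t^x + 2^x − t^(−x) + m·x·(t − 1). -/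
lemma aux_deriv (p t : ℝ) (ht : 1 ≤ t) :
    HasDerivAt (fun s : ℝ => (1 + s) ^ p - s ^ p)
      (p * (1 + t) ^ (p - 1) - p * t ^ (p - 1)) t := by
  have h1 : HasDerivAt (fun s : ℝ => (1 + s) ^ p) (1 * p * (1 + t) ^ (p - 1)) t :=
    ((hasDerivAt_id t).const_add 1).rpow_const (Or.inl (by simp only [id]; linarith))
  have h2 : HasDerivAt (fun s : ℝ => s ^ p) (1 * p * t ^ (p - 1)) t :=
    (hasDerivAt_id t).rpow_const (Or.inl (by simp only [id]; linarith))
  rw [one_mul] at h1 h2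
  exact h1.sub h2

lemma mono_of_hasDeriv (f f' : ℝ → ℝ) (h : ∀ t, 1 ≤ t → HasDerivAt f (f' t) t)
    (h0 : ∀ t, 1 ≤ t → 0 ≤ f' t) (t : ℝ) (ht : 1 ≤ t) : f 1 ≤ f t := by
  have : MonotoneOn f (Set.Ici 1) := by
    apply monotoneOn_of_deriv_nonneg (convex_Ici 1)
    · exact fun s hs => (h s hs).continuousAt.continuousWithinAt
    · intro s hs
      exact (h s (interior_subset hs)).differentiableAt.differentiableWithinAt
    · intro s hs
      rw [(h s (interior_subset hs)).deriv]
      exact h0 s (interior_subset hs)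
  exact this Set.self_mem_Ici ht ht

lemma aux_mono (p t : ℝ) (hp : 1 ≤ p) (ht : 1 ≤ t) :
    (2 : ℝ) ^ p - 1 ≤ (1 + t) ^ p - t ^ p := by
  have := mono_of_hasDeriv _ _ (aux_deriv p) (fun s hs => by
    have : s ^ (p - 1) ≤ (1 + s) ^ (p - 1) :=
      Real.rpow_le_rpow (by linarith) (by linarith) (by linarith)
    nlinarith) t ht
  norm_num at this
  linarith

/-- Corollary 2.2(ii): the `k = 1` case of the parametrized bound, for `t ≥ 1`. -/
theorem parametrized_bound_case2_k_one (m x t : ℝ) (hm : 0 ≤ m)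
    (hx : 1 + Real.logb 2 (m + 2) ≤ x)
    (ht : 1 ≤ t) :
    (1 + t) ^ x ≥ t ^ x + (2 : ℝ) ^ x - t ^ (-x) + m * x * (t - 1) := by
  have hm2 : m + 2 ≤ (2 : ℝ) ^ (x - 1) :=
    (Real.logb_le_iff_le_rpow (by norm_num) (by linarith)).1 (by linarith)
  have hl : 1 ≤ Real.logb 2 (m + 2) := by
    rw [Real.le_logb_iff_rpow_le (by norm_num) (by linarith)]
    norm_num; linarith
  have key := mono_of_hasDeriv
    (fun s => ((1 + s) ^ x - s ^ x) + s ^ (-x) - m * x * (s - 1))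
    (fun s => (x * (1 + s) ^ (x - 1) - x * s ^ (x - 1)) + 1 * (-x) * s ^ (-x - 1) - m * x * 1)
    (fun s hs => by
      have h2 : HasDerivAt (fun s : ℝ => s ^ (-x)) (1 * (-x) * s ^ (-x - 1)) s :=
        (hasDerivAt_id s).rpow_const (Or.inl (by simp only [id]; linarith))
      exact ((aux_deriv x s hs).add h2).sub (((hasDerivAt_id s).sub_const 1).const_mul (m * x)))
    (fun s hs => by
      have h1 := aux_mono (x - 1) s (by linarith) hs
      have h2 : s ^ (-x - 1) ≤ 1 := Real.rpow_le_one_of_one_le_of_nonpos hs (by linarith)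
      have h3 : 0 ≤ x * ((1 + s) ^ (x - 1) - s ^ (x - 1) - s ^ (-x - 1) - m) :=
        mul_nonneg (by linarith) (by linarith)
      linarith) t ht
  norm_num at key
  linarith
end

section
/- For all real x ≥ 2 and all real y ≥ 1, one has (1+y)^(x−1) − y^(x−1) − y^(−x−1) ≥ 2^(x−1) − 2; equivalently, the partial derivative x(1+y)^(x−1) − x·y^(x−1) − x·y^(−x−1) − m·x of h(x,y) = (1+y)^x − y^x + y^(−x) − m x y with respect to y is bounded below by its value x(2^(x−1) − 2 − m) at y = 1. -/
/-- Derivative estimate (2.7): for `x ≥ 2` and `y ≥ 1`,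
`(1+y)^(x-1) - y^(x-1) - y^(-x-1) ≥ 2^(x-1) - 2`; equivalently, the partial derivative
`x(1+y)^(x-1) - x·y^(x-1) - x·y^(-x-1) - m·x` of `h(x,y)` with respect to `y` is bounded
below by its value `x(2^(x-1) - 2 - m)` at `y = 1`. -/
theorem derivative_estimate (x y : ℝ) (hx : 2 ≤ x) (hy : 1 ≤ y) :
    ((1 + y) ^ (x - 1) - y ^ (x - 1) - y ^ (-x - 1) ≥ (2 : ℝ) ^ (x - 1) - 2) ∧
    ∀ m : ℝ,
      x * (1 + y) ^ (x - 1) - x * y ^ (x - 1) - x * y ^ (-x - 1) - m * x ≥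
        x * ((2 : ℝ) ^ (x - 1) - 2 - m) := by
  have hy0 : 0 < y := by linarith
  have hc := convexOn_rpow (show (1 : ℝ) ≤ x - 1 by linarith)
  have hs0 : 0 ≤ 1 / y := by positivity
  have hs1 : 0 ≤ 1 - 1 / y := by
    rw [sub_nonneg, div_le_one hy0]
    exact hy
  have m1 : (1 : ℝ) ∈ Set.Ici (0 : ℝ) := Set.mem_Ici.2 zero_le_one
  have m2 : (1 + y : ℝ) ∈ Set.Ici (0 : ℝ) := Set.mem_Ici.2 (by linarith)
  have h1 := hc.2 m1 m2 hs1 hs0 (by ring)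
  have h2 := hc.2 m1 m2 hs0 hs1 (by ring)
  have e1 : (1 - 1 / y) * 1 + (1 / y) * (1 + y) = 2 := by
    field_simp
    ring
  have e2 : (1 / y) * 1 + (1 - 1 / y) * (1 + y) = y := by
    field_simp
    ring
  simp only [smul_eq_mul, Real.one_rpow] at h1 h2
  rw [e1] at h1
  rw [e2] at h2
  have h3 : y ^ (-x - 1) ≤ 1 := Real.rpow_le_one_of_one_le_of_nonpos hy (by linarith)
  have key : (1 + y) ^ (x - 1) - y ^ (x - 1) - y ^ (-x - 1) ≥ (2 : ℝ) ^ (x - 1) - 2 := by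
    linarith
  refine ⟨key, fun m => ?_⟩
  have := mul_le_mul_of_nonneg_left key (show 0 ≤ x by linarith)
  linarith
end

section
/- Let m ≥ 0, x ≥ 1 + log₂(m+2), and 0 < t ≤ k ≤ 1. Then the following chain of inequalities holds: (1+t)^x ≥ 1 + ( ((1+k)^x − 1)/k^x + k^x − t^x )·t^x + m·x·(1/t − 1/k)·t^x ≥ 1 + ( ((1+k)^x − 1)/k^x + k^x − t^x )·t^x ≥ 1 + ( ((1+k)^x − 1)/k^x )·t^x ≥ 1 + (2^x − 1)·t^x ≥ 1 + x·t^x ≥ 1 + t^x. -/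
theorem aux_diff (p : ℝ) (hp : 1 ≤ p) (s : ℝ) (hs : 1 ≤ s) :
    (2 : ℝ) ^ p - 1 ≤ (1 + s) ^ p - s ^ p := by
  have hd : ∀ y : ℝ, 0 < y → HasDerivAt (fun y : ℝ => (1 + y) ^ p - y ^ p)
      (1 * p * (1 + y) ^ (p - 1) - 1 * p * y ^ (p - 1)) y := by
    intro y hy
    have h1 : HasDerivAt (fun y : ℝ => 1 + y) 1 y := (hasDerivAt_id y).const_add 1
    exact (h1.rpow_const (Or.inl (by positivity))).sub
      ((hasDerivAt_id y).rpow_const (Or.inl hy.ne'))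
  have hmono : MonotoneOn (fun y : ℝ => (1 + y) ^ p - y ^ p) (Set.Ici 1) := by
    apply monotoneOn_of_deriv_nonneg (convex_Ici 1)
    · intro y hy
      exact (hd y (lt_of_lt_of_le one_pos hy)).continuousAt.continuousWithinAt
    · intro y hy
      rw [interior_Ici] at hy
      exact (hd y (lt_trans one_pos hy)).differentiableAt.differentiableWithinAt
    · intro y hy
      rw [interior_Ici] at hy
      have hy0 : (0 : ℝ) < y := lt_trans one_pos hy
      rw [(hd y hy0).deriv]
      have : y ^ (p - 1) ≤ (1 + y) ^ (p - 1) :=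
        Real.rpow_le_rpow hy0.le (by linarith) (by linarith)
      nlinarith
  have := hmono (Set.mem_Ici.2 le_rfl) (Set.mem_Ici.2 hs) hs
  simp only [Real.one_rpow] at this
  norm_num at this
  linarith

theorem aux_mono_s6 (m x : ℝ) (hx : 2 ≤ x) (h2 : m + 2 ≤ (2 : ℝ) ^ (x - 1)) (a b : ℝ)
    (ha : 1 ≤ a) (hab : a ≤ b) :
    (1 + a) ^ x - a ^ x + a ^ (-x) - m * x * a ≤
      (1 + b) ^ x - b ^ x + b ^ (-x) - m * x * b := by
  have hd : ∀ y : ℝ, 0 < y →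
      HasDerivAt (fun y : ℝ => (1 + y) ^ x - y ^ x + y ^ (-x) - m * x * y)
      (1 * x * (1 + y) ^ (x - 1) - 1 * x * y ^ (x - 1) + 1 * (-x) * y ^ (-x - 1)
        - m * x * 1) y := by
    intro y hy
    have h1 : HasDerivAt (fun y : ℝ => 1 + y) 1 y := (hasDerivAt_id y).const_add 1
    exact (((h1.rpow_const (Or.inl (by positivity))).sub
      ((hasDerivAt_id y).rpow_const (Or.inl hy.ne'))).add
      ((hasDerivAt_id y).rpow_const (Or.inl hy.ne'))).sub
      ((hasDerivAt_id y).const_mul (m * x))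
  have hmono : MonotoneOn (fun y : ℝ => (1 + y) ^ x - y ^ x + y ^ (-x) - m * x * y)
      (Set.Ici 1) := by
    apply monotoneOn_of_deriv_nonneg (convex_Ici 1)
    · intro y hy
      exact (hd y (lt_of_lt_of_le one_pos hy)).continuousAt.continuousWithinAt
    · intro y hy
      rw [interior_Ici] at hy
      exact (hd y (lt_trans one_pos hy)).differentiableAt.differentiableWithinAt
    · intro y hy
      rw [interior_Ici] at hy
      have hy1 : (1 : ℝ) < y := hy
      have hy0 : (0 : ℝ) < y := lt_trans one_pos hy
      rw [(hd y hy0).deriv]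
      have e1 := aux_diff (x - 1) (by linarith) y hy1.le
      have e2 : y ^ (-x - 1) ≤ 1 := Real.rpow_le_one_of_one_le_of_nonpos hy1.le (by linarith)
      have e3 : 0 ≤ (1 + y) ^ (x - 1) - y ^ (x - 1) - y ^ (-x - 1) - m := by linarith
      have e4 := mul_nonneg (show (0 : ℝ) ≤ x by linarith) e3
      linarith
  exact hmono (Set.mem_Ici.2 ha) (Set.mem_Ici.2 (ha.trans hab)) hab

theorem aux_inv (x t : ℝ) (ht : 0 < t) :
    (1 + 1 / t) ^ x - (1 / t) ^ x = ((1 + t) ^ x - 1) / t ^ x := by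
  have h : 1 + 1 / t = (1 + t) / t := by field_simp; ring
  rw [h, Real.div_rpow (by positivity) ht.le, Real.div_rpow one_pos.le ht.le, Real.one_rpow]
  ring

/-- Case 1 comparison chain: for `m ≥ 0`, `x ≥ 1 + log₂(m+2)` and `0 < t ≤ k ≤ 1`,
the parametrized bound dominates all previously known lower bounds for `(1+t)^x`. -/
theorem comparison_chain_case1 (m x t k : ℝ) (hm : 0 ≤ m)
    (hx : 1 + Real.logb 2 (m + 2) ≤ x)
    (ht : 0 < t) (htk : t ≤ k) (hk : k ≤ 1) :
    (1 + t) ^ x ≥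
        1 + (((1 + k) ^ x - 1) / k ^ x + k ^ x - t ^ x) * t ^ x
          + m * x * (1 / t - 1 / k) * t ^ x ∧
    1 + (((1 + k) ^ x - 1) / k ^ x + k ^ x - t ^ x) * t ^ x
        + m * x * (1 / t - 1 / k) * t ^ x ≥
      1 + (((1 + k) ^ x - 1) / k ^ x + k ^ x - t ^ x) * t ^ x ∧
    1 + (((1 + k) ^ x - 1) / k ^ x + k ^ x - t ^ x) * t ^ x ≥
      1 + (((1 + k) ^ x - 1) / k ^ x) * t ^ x ∧
    1 + (((1 + k) ^ x - 1) / k ^ x) * t ^ x ≥ 1 + ((2 : ℝ) ^ x - 1) * t ^ x ∧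
    1 + ((2 : ℝ) ^ x - 1) * t ^ x ≥ 1 + x * t ^ x ∧
    1 + x * t ^ x ≥ 1 + t ^ x := by
  have hlog : 1 ≤ Real.logb 2 (m + 2) := by
    rw [Real.le_logb_iff_rpow_le (by norm_num) (by linarith), Real.rpow_one]
    linarith
  have hx2 : 2 ≤ x := by linarith
  have h2 : m + 2 ≤ (2 : ℝ) ^ (x - 1) := by
    rw [← Real.logb_le_iff_le_rpow (by norm_num) (by linarith)]
    linarith
  have hk0 : 0 < k := lt_of_lt_of_le ht htk
  have hT : 0 < t ^ x := Real.rpow_pos_of_pos ht x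
  have hTK : t ^ x ≤ k ^ x := Real.rpow_le_rpow ht.le htk (by linarith)
  have hk1 : 1 ≤ 1 / k := by rw [le_div_iff₀ hk0]; linarith
  have hkt : 1 / k ≤ 1 / t := one_div_le_one_div_of_le ht htk
  refine ⟨?_, ?_, ?_, ?_, ?_, ?_⟩
  · have h := aux_mono_s6 m x hx2 h2 (1 / k) (1 / t) hk1 hkt
    have i1 : (1 / k) ^ (-x) = k ^ x := by
      rw [one_div, Real.inv_rpow hk0.le, Real.rpow_neg hk0.le, inv_inv]
    have i2 : (1 / t) ^ (-x) = t ^ x := by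
      rw [one_div, Real.inv_rpow ht.le, Real.rpow_neg ht.le, inv_inv]
    rw [aux_inv x k hk0, aux_inv x t ht, i1, i2] at h
    have h3 : ((1 + k) ^ x - 1) / k ^ x + k ^ x - t ^ x + m * x * (1 / t - 1 / k) ≤
      ((1 + t) ^ x - 1) / t ^ x := by linarith
    rw [le_div_iff₀ hT] at h3
    linarith
  · have : 0 ≤ m * x * (1 / t - 1 / k) * t ^ x :=
      mul_nonneg (mul_nonneg (mul_nonneg hm (by linarith)) (by linarith)) hT.le
    linarith
  · have : 0 ≤ (k ^ x - t ^ x) * t ^ x := mul_nonneg (by linarith) hT.le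
    linarith
  · have h := aux_diff x (by linarith) (1 / k) hk1
    rw [aux_inv x k hk0] at h
    have := mul_le_mul_of_nonneg_right h hT.le
    linarith
  · have h := one_add_mul_self_le_rpow_one_add (s := 1) (by norm_num) (p := x) (by linarith)
    norm_num at h
    have := mul_le_mul_of_nonneg_right (show x ≤ (2 : ℝ) ^ x - 1 by linarith) hT.le
    linarith
  · have := mul_le_mul_of_nonneg_right (show 1 ≤ x by linarith) hT.le
    linarith
end

section
/- Let m ≥ 0, x ≥ 1 + log₂(m+2), and t ≥ k ≥ 1. Then the following chain of inequalities holds: (1+t)^x ≥ t^x + (1+k)^x − k^x + k^(−x) − t^(−x) + m·x·(t − k) ≥ t^x + (1+k)^x − k^x + k^(−x) − t^(−x) ≥ t^x + (1+k)^x − k^x ≥ t^x + 2^x − 1 ≥ t^x + 1. -/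
lemma aux_mono_s7 (p : ℝ) (hp : 1 ≤ p) :
    MonotoneOn (fun s : ℝ => (1 + s) ^ p - s ^ p) (Set.Ici 1) := by
  have hd : ∀ s : ℝ, 1 ≤ s → HasDerivAt (fun s : ℝ => (1 + s) ^ p - s ^ p)
      (1 * p * (1 + s) ^ (p - 1) - 1 * p * s ^ (p - 1)) s := by
    intro s hs
    exact (((hasDerivAt_id s).const_add 1).rpow_const (Or.inl (by simp only [id]; linarith))).sub
      ((hasDerivAt_id s).rpow_const (Or.inl (by simp only [id]; linarith)))
  apply monotoneOn_of_deriv_nonneg (convex_Ici 1)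
  · exact fun s hs => (hd s hs).continuousAt.continuousWithinAt
  · exact fun s hs => (hd s (interior_subset hs)).differentiableAt.differentiableWithinAt
  · intro s hs
    have hs1 : (1 : ℝ) ≤ s := interior_subset hs
    rw [(hd s hs1).deriv]
    have h := Real.rpow_le_rpow (by linarith : 0 ≤ s) (by linarith : s ≤ 1 + s)
      (by linarith : 0 ≤ p - 1)
    nlinarith

lemma aux_mono2 (m x : ℝ) (hx : 2 ≤ x) (hm : m + 2 ≤ (2 : ℝ) ^ (x - 1)) :
    MonotoneOn (fun s : ℝ => (1 + s) ^ x - s ^ x + s ^ (-x) - m * x * s) (Set.Ici 1) := by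
  have hd : ∀ s : ℝ, 1 ≤ s →
      HasDerivAt (fun s : ℝ => (1 + s) ^ x - s ^ x + s ^ (-x) - m * x * s)
      (1 * x * (1 + s) ^ (x - 1) - 1 * x * s ^ (x - 1) + 1 * (-x) * s ^ (-x - 1)
        - m * x * 1) s := by
    intro s hs
    have hs0 : s ≠ 0 := by linarith
    have hs1 : 1 + s ≠ 0 := by linarith
    exact (((((hasDerivAt_id s).const_add 1).rpow_const (Or.inl hs1)).sub
      ((hasDerivAt_id s).rpow_const (Or.inl hs0))).add
      ((hasDerivAt_id s).rpow_const (Or.inl hs0))).sub ((hasDerivAt_id s).const_mul (m * x))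
  apply monotoneOn_of_deriv_nonneg (convex_Ici 1)
  · exact fun s hs => (hd s hs).continuousAt.continuousWithinAt
  · exact fun s hs => (hd s (interior_subset hs)).differentiableAt.differentiableWithinAt
  · intro s hs
    have hs1 : (1 : ℝ) ≤ s := interior_subset hs
    rw [(hd s hs1).deriv]
    have h := aux_mono_s7 (x - 1) (by linarith) (Set.mem_Ici.2 le_rfl) (Set.mem_Ici.2 hs1) hs1
    simp only [Real.one_rpow] at h
    norm_num at h
    have h2 : s ^ (-x - 1) ≤ 1 := Real.rpow_le_one_of_one_le_of_nonpos hs1 (by linarith)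
    have h3 : 0 ≤ x * ((1 + s) ^ (x - 1) - s ^ (x - 1) - s ^ (-x - 1) - m) :=
      mul_nonneg (by linarith) (by linarith)
    linarith

/-- Case 2 comparison chain: for `m ≥ 0`, `x ≥ 1 + log₂(m+2)` and `t ≥ k ≥ 1`,
the parametrized bound dominates all previously known lower bounds for `(1+t)^x`. -/
theorem comparison_chain_case2 (m x t k : ℝ) (hm : 0 ≤ m)
    (hx : 1 + Real.logb 2 (m + 2) ≤ x)
    (hk : 1 ≤ k) (htk : k ≤ t) :
    (1 + t) ^ x ≥
        t ^ x + (1 + k) ^ x - k ^ x + k ^ (-x) - t ^ (-x) + m * x * (t - k) ∧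
    t ^ x + (1 + k) ^ x - k ^ x + k ^ (-x) - t ^ (-x) + m * x * (t - k) ≥
      t ^ x + (1 + k) ^ x - k ^ x + k ^ (-x) - t ^ (-x) ∧
    t ^ x + (1 + k) ^ x - k ^ x + k ^ (-x) - t ^ (-x) ≥ t ^ x + (1 + k) ^ x - k ^ x ∧
    t ^ x + (1 + k) ^ x - k ^ x ≥ t ^ x + (2 : ℝ) ^ x - 1 ∧
    t ^ x + (2 : ℝ) ^ x - 1 ≥ t ^ x + 1 := by
  have hm2 : (0 : ℝ) < m + 2 := by linarith
  have hlog : 1 ≤ Real.logb 2 (m + 2) := by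
    rw [Real.le_logb_iff_rpow_le (by norm_num) hm2]
    norm_num
    exact hm
  have hx2 : 2 ≤ x := by linarith
  have hpow : m + 2 ≤ (2 : ℝ) ^ (x - 1) := by
    rw [← Real.logb_le_iff_le_rpow (by norm_num) hm2]
    linarith
  have ht : 1 ≤ t := hk.trans htk
  have h1 := aux_mono2 m x hx2 hpow (Set.mem_Ici.2 hk) (Set.mem_Ici.2 ht) htk
  have h2 := aux_mono_s7 x (by linarith) (Set.mem_Ici.2 le_rfl) (Set.mem_Ici.2 hk) hk
  simp only [Real.one_rpow] at h1 h2
  norm_num at h2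
  have h3 : 0 ≤ m * x * (t - k) :=
    mul_nonneg (mul_nonneg hm (by linarith)) (by linarith)
  have h4 : t ^ (-x) ≤ k ^ (-x) :=
    Real.rpow_le_rpow_of_nonpos (by linarith) htk (by linarith)
  have h5 : (2 : ℝ) ^ (1 : ℝ) ≤ 2 ^ x :=
    Real.rpow_le_rpow_of_exponent_le (by norm_num) (by linarith)
  rw [Real.rpow_one] at h5
  refine ⟨?_, ?_, ?_, ?_, ?_⟩ <;> linarith
end

section
/- For all real x ≥ 2 and all real k with 0 < k ≤ 1, one has ((1+k)^x − 1)/k^x ≥ 2^x − 1. -/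
/-- For `x ≥ 2` and `0 < k ≤ 1`, `((1+k)^x - 1)/k^x ≥ 2^x - 1`. -/
theorem coefficient_comparison_case1 (x k : ℝ) (hx : 2 ≤ x)
    (hk0 : 0 < k) (hk1 : k ≤ 1) :
    ((1 + k) ^ x - 1) / k ^ x ≥ (2 : ℝ) ^ x - 1 := by
  have hc := convexOn_rpow (p := x) (by linarith)
  have m1 : (1 + k) ∈ Set.Ici (0 : ℝ) := by simp only [Set.mem_Ici]; linarith
  have m2 : k ∈ Set.Ici (0 : ℝ) := hk0.le
  have h1 := hc.2 m1 m2 (sub_nonneg.2 hk1) hk0.le (by ring)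
  have h2 := hc.2 m1 m2 hk0.le (sub_nonneg.2 hk1) (by ring)
  simp only [smul_eq_mul] at h1 h2
  rw [show (1 - k) * (1 + k) + k * k = 1 by ring, Real.one_rpow] at h1
  rw [show k * (1 + k) + (1 - k) * k = 2 * k by ring,
    Real.mul_rpow (by norm_num) hk0.le] at h2
  rw [ge_iff_le, le_div_iff₀ (Real.rpow_pos_of_pos hk0 x)]
  linarith
end

section
/- For all real x ≥ 2 and all real k ≥ 1, one has (1+k)^x − k^x + k^(−x) ≥ 2^x; in particular (1+k)^x − k^x ≥ 2^x − 1. -/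
/-- For `x ≥ 2` and `k ≥ 1`, `(1+k)^x - k^x + k^(-x) ≥ 2^x`; in particular
`(1+k)^x - k^x ≥ 2^x - 1`. -/
theorem coefficient_comparison_case2 (x k : ℝ) (hx : 2 ≤ x) (hk : 1 ≤ k) :
    (1 + k) ^ x - k ^ x + k ^ (-x) ≥ (2 : ℝ) ^ x ∧
    (1 + k) ^ x - k ^ x ≥ (2 : ℝ) ^ x - 1 := by
  have hd : ∀ t : ℝ, 1 ≤ t → HasDerivAt (fun t : ℝ => (1 + t) ^ x - t ^ x + t ^ (-x))
      (x * ((1 + t) ^ (x - 1) - t ^ (x - 1) - t ^ (-x - 1))) t := by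
    intro t ht
    have h1 : HasDerivAt (fun t : ℝ => (1 + t) ^ x) (1 * x * (1 + t) ^ (x - 1)) t :=
      ((hasDerivAt_id t).const_add 1).rpow_const (Or.inl (by simp only [id]; linarith))
    have h2 := Real.hasDerivAt_rpow_const (x := t) (p := x) (Or.inl (by linarith))
    have h3 := Real.hasDerivAt_rpow_const (x := t) (p := -x) (Or.inl (by linarith))
    exact ((h1.sub h2).add h3).congr_deriv (by ring)
  have hm : MonotoneOn (fun t : ℝ => (1 + t) ^ x - t ^ x + t ^ (-x)) (Set.Ici 1) := by
    refine monotoneOn_of_deriv_nonneg (convex_Ici 1)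
      (fun t ht => (hd t ht).continuousAt.continuousWithinAt)
      (fun t ht => (hd t (interior_subset ht)).differentiableAt.differentiableWithinAt) ?_
    intro t ht
    have ht1 : (1 : ℝ) ≤ t := interior_subset ht
    rw [(hd t ht1).deriv]
    have h1 := Real.add_rpow_le_rpow_add (a := 1) (b := t) (p := x - 1)
      (by norm_num) (by linarith) (by linarith)
    rw [Real.one_rpow] at h1
    have h2 : t ^ (-x - 1) ≤ 1 := Real.rpow_le_one_of_one_le_of_nonpos ht1 (by linarith)
    exact mul_nonneg (by linarith) (by linarith)
  have h := hm (Set.mem_Ici.2 le_rfl) (Set.mem_Ici.2 hk) hk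
  simp only [Real.one_rpow] at h
  norm_num at h
  have h2 : k ^ (-x) ≤ 1 := Real.rpow_le_one_of_one_le_of_nonpos hk (by linarith)
  constructor <;> linarith
end

section
/- Let γ > 0, m ≥ 0, 0 < k ≤ 1, and α ≥ (1 + log₂(m+2))·γ. Let E_ABC, E_AB, E_AC be real numbers with E_AB > 0, E_AC > 0, k·E_AB^γ ≥ E_AC^γ, and suppose the γ-th monogamy relation E_ABC^γ ≥ E_AB^γ + E_AC^γ holds (with E_ABC ≥ 0). Then E_ABC^α ≥ E_AB^α + [ ((1+k)^(α/γ) − 1)/k^(α/γ) + k^(α/γ) − E_AC^α / E_AB^α + (m·α/γ)·(E_AB^γ / E_AC^γ − 1/k) ] · E_AC^α. -/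
lemma aux_inner (q x : ℝ) (hq : 1 ≤ q) (hx : 1 ≤ x) :
    (2:ℝ) ^ q - 1 ≤ (1 + x) ^ q - x ^ q := by
  have hd : ∀ x : ℝ, 1 ≤ x → HasDerivAt (fun x : ℝ => (1 + x) ^ q - x ^ q)
      (1 * q * (1 + x) ^ (q - 1) - 1 * q * x ^ (q - 1)) x := by
    intro x hx
    exact (((hasDerivAt_id x).const_add 1).rpow_const (Or.inr hq)).sub
      ((hasDerivAt_id x).rpow_const (Or.inr hq))
  have hmon : MonotoneOn (fun x : ℝ => (1 + x) ^ q - x ^ q) (Set.Ici 1) := by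
    apply monotoneOn_of_deriv_nonneg (convex_Ici 1)
    · intro x hx
      exact (hd x hx).continuousAt.continuousWithinAt
    · intro x hx
      rw [interior_Ici] at hx
      exact (hd x (le_of_lt hx)).differentiableAt.differentiableWithinAt
    · intro x hx
      rw [interior_Ici] at hx
      have hx1 : 1 < x := hx
      rw [(hd x hx1.le).deriv]
      have : x ^ (q - 1) ≤ (1 + x) ^ (q - 1) :=
        Real.rpow_le_rpow (by linarith) (by linarith) (by linarith)
      nlinarith
  have h := hmon (Set.mem_Ici.2 le_rfl) (Set.mem_Ici.2 hx) hx
  simp only [Real.one_rpow] at h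
  norm_num at h ⊢
  linarith

lemma aux_outer (p m x y : ℝ) (hm : 0 ≤ m) (hp : 1 + Real.logb 2 (m + 2) ≤ p)
    (hy : 1 ≤ y) (hyx : y ≤ x) :
    (1 + y) ^ p - y ^ p + y ^ (-p) - m * p * y ≤
      (1 + x) ^ p - x ^ p + x ^ (-p) - m * p * x := by
  have hlog : 1 ≤ Real.logb 2 (m + 2) := by
    rw [Real.le_logb_iff_rpow_le (by norm_num) (by linarith)]
    rw [Real.rpow_one]; linarith
  have h2 : m + 2 ≤ (2:ℝ) ^ (p - 1) := by
    rw [← Real.logb_le_iff_le_rpow (by norm_num) (by linarith)]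
    linarith
  have hp1 : 1 ≤ p := by linarith
  have hd : ∀ x : ℝ, 1 ≤ x →
      HasDerivAt (fun x : ℝ => (1 + x) ^ p - x ^ p + x ^ (-p) - m * p * x)
      (1 * p * (1 + x) ^ (p - 1) - 1 * p * x ^ (p - 1) + 1 * (-p) * x ^ (-p - 1)
        - m * p * 1) x := by
    intro x hx
    exact (((((hasDerivAt_id x).const_add 1).rpow_const (Or.inr hp1)).sub
      ((hasDerivAt_id x).rpow_const (Or.inr hp1))).add
      ((hasDerivAt_id x).rpow_const (Or.inl (by simp; linarith)))).sub
      ((hasDerivAt_id x).const_mul (m * p))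
  have hmon : MonotoneOn (fun x : ℝ => (1 + x) ^ p - x ^ p + x ^ (-p) - m * p * x)
      (Set.Ici 1) := by
    apply monotoneOn_of_deriv_nonneg (convex_Ici 1)
    · intro x hx
      exact (hd x hx).continuousAt.continuousWithinAt
    · intro x hx
      rw [interior_Ici] at hx
      exact (hd x (le_of_lt hx)).differentiableAt.differentiableWithinAt
    · intro x hx
      rw [interior_Ici] at hx
      have hx1 : 1 < x := hx
      rw [(hd x hx1.le).deriv]
      have h3 := aux_inner (p - 1) x (by linarith) hx1.le
      have h4 : x ^ (-p - 1) ≤ 1 :=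
        Real.rpow_le_one_of_one_le_of_nonpos hx1.le (by linarith)
      have : 0 ≤ p * ((1 + x) ^ (p - 1) - x ^ (p - 1) - x ^ (-p - 1) - m) :=
        mul_nonneg (by linarith) (by linarith)
      linarith
  exact hmon (Set.mem_Ici.2 hy) (Set.mem_Ici.2 (hy.trans hyx)) hyx


/-- Theorem 3.2: tighter α-th monogamy relation for a tripartite state, with
a priori ratio information `k·E_AB^γ ≥ E_AC^γ`. -/
theorem tighter_monogamy_tripartite_k (γ m k α E_ABC E_AB E_AC : ℝ)
    (hγ : 0 < γ) (hm : 0 ≤ m) (hk0 : 0 < k) (hk1 : k ≤ 1)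
    (hα : (1 + Real.logb 2 (m + 2)) * γ ≤ α)
    (hAB : 0 < E_AB) (hAC : 0 < E_AC)
    (hABAC : k * E_AB ^ γ ≥ E_AC ^ γ)
    (hABC : 0 ≤ E_ABC)
    (hmono : E_ABC ^ γ ≥ E_AB ^ γ + E_AC ^ γ) :
    E_ABC ^ α ≥
      E_AB ^ α +
        (((1 + k) ^ (α / γ) - 1) / k ^ (α / γ) + k ^ (α / γ)
          - E_AC ^ α / E_AB ^ α
          + m * α / γ * (E_AB ^ γ / E_AC ^ γ - 1 / k)) * E_AC ^ α := by

  obtain ⟨p, hpdef⟩ : ∃ p, p = α / γ := ⟨_, rfl⟩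
  have hαp : α = γ * p := by rw [hpdef]; field_simp
  have hp : 1 + Real.logb 2 (m + 2) ≤ p := by
    rw [hpdef, le_div_iff₀ hγ]; exact hα
  have hp0 : 0 ≤ p := by
    have : 0 ≤ Real.logb 2 (m + 2) := Real.logb_nonneg (by norm_num) (by linarith)
    linarith
  rw [mul_div_assoc, ← hpdef, hαp, Real.rpow_mul hABC, Real.rpow_mul hAB.le,
    Real.rpow_mul hAC.le]
  have hA : 0 < E_AB ^ γ := Real.rpow_pos_of_pos hAB _
  have hC : 0 < E_AC ^ γ := Real.rpow_pos_of_pos hAC _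
  generalize E_AB ^ γ = A at *
  generalize E_AC ^ γ = C at *
  have hy1 : 1 ≤ 1 / k := by rw [le_div_iff₀ hk0]; linarith
  have hyx : 1 / k ≤ A / C := by
    rw [div_le_div_iff₀ hk0 hC]; linarith
  have key := aux_outer p m (A / C) (1 / k) hm hp hy1 hyx
  have hkp : 0 < k ^ p := Real.rpow_pos_of_pos hk0 _
  have hAp : 0 < A ^ p := Real.rpow_pos_of_pos hA _
  have hCp : 0 < C ^ p := Real.rpow_pos_of_pos hC _
  have e1 : (1 + 1 / k) ^ p = (1 + k) ^ p / k ^ p := by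
    rw [← Real.div_rpow (by linarith) hk0.le]; congr 1; field_simp; ring
  have e2 : (1 / k) ^ p = 1 / k ^ p := by
    rw [Real.div_rpow zero_le_one hk0.le, Real.one_rpow]
  have e3 : (1 / k) ^ (-p) = k ^ p := by
    rw [Real.rpow_neg (by positivity), e2]; simp
  have e4 : (1 + A / C) ^ p = (A + C) ^ p / C ^ p := by
    rw [← Real.div_rpow (by linarith) hC.le]; congr 1; field_simp; ring
  have e5 : (A / C) ^ p = A ^ p / C ^ p := Real.div_rpow hA.le hC.le _
  have e6 : (A / C) ^ (-p) = C ^ p / A ^ p := by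
    rw [Real.rpow_neg (by positivity), e5, inv_div]
  rw [e1, e2, e3, e4, e5, e6] at key
  have hmain : (A + C) ^ p ≤ (E_ABC ^ γ) ^ p :=
    Real.rpow_le_rpow (by linarith) hmono hp0
  refine le_trans ?_ hmain
  have k2 := mul_le_mul_of_nonneg_right key hCp.le
  have e7 : (A + C) ^ p / C ^ p * C ^ p = (A + C) ^ p := div_mul_cancel₀ _ hCp.ne'
  have e8 : A ^ p / C ^ p * C ^ p = A ^ p := div_mul_cancel₀ _ hCp.ne'
  rw [sub_div]
  linarith
end

section
/- Let γ > 0, m ≥ 0, 0 < k ≤ 1, α ≥ (1 + log₂(m+2))·γ, and let N ≥ 3. Let e_1, …, e_{N−1} > 0 and f_1, …, f_{N−1} > 0 be real numbers with f_{N−1} = e_{N−1}, satisfying the monogamy relations f_i^γ ≥ e_i^γ + f_{i+1}^γ for i = 1, …, N−2, and assume k·e_i^γ ≥ f_{i+1}^γ for i = 1, …, N−2. Set M = ((1+k)^(α/γ) − 1)/k^(α/γ) + k^(α/γ), and for i = 1, …, N−2 set M_i = M − f_{i+1}^α / e_i^α and T_i = (m·α/γ)·(e_i^γ / f_{i+1}^γ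 − 1/k). Then f_1^α ≥ e_1^α + Σ_{i=1}^{N−2} ( Π_{j=1}^{i} (M_j + T_j) ) · e_{i+1}^α. -/
theorem aux_conv_s13 (p t : ℝ) (hp : 1 ≤ p) (ht0 : 0 < t) (ht1 : t ≤ 1) :
    1 + (2 ^ p - 1) * t ^ p ≤ (1 + t) ^ p := by
  have hc := convexOn_rpow hp
  have hx : (1 + t) ∈ Set.Ici (0 : ℝ) := by rw [Set.mem_Ici]; linarith
  have hy : t ∈ Set.Ici (0 : ℝ) := ht0.le
  have h1 := hc.2 hx hy (show 0 ≤ 1 - t by linarith) ht0.le (by ring)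
  have h2 := hc.2 hx hy ht0.le (show 0 ≤ 1 - t by linarith) (by ring)
  simp only [smul_eq_mul] at h1 h2
  rw [show (1 - t) * (1 + t) + t * t = 1 by ring, Real.one_rpow] at h1
  rw [show t * (1 + t) + (1 - t) * t = 2 * t by ring,
    Real.mul_rpow (by norm_num) ht0.le] at h2
  linarith

theorem aux_deriv_s13 (s m t : ℝ) (hm : 0 ≤ m) (hs : 1 + Real.logb 2 (m + 2) ≤ s)
    (ht0 : 0 < t) (ht1 : t ≤ 1) :
    1 + t ^ (2 * s) + m * t ^ (s - 1) ≤ (1 + t) ^ (s - 1) := by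
  have hl : Real.logb 2 (m + 2) ≤ s - 1 := by linarith
  have hl1 : 1 ≤ Real.logb 2 (m + 2) := by
    rw [Real.le_logb_iff_rpow_le (by norm_num) (by linarith)]
    simpa using hm
  have h2 : m + 2 ≤ 2 ^ (s - 1) :=
    (Real.logb_le_iff_le_rpow (by norm_num) (by linarith)).1 hl
  have h1 := aux_conv_s13 (s - 1) t (by linarith) ht0 ht1
  have h3 : t ^ (2 * s) ≤ t ^ (s - 1) :=
    Real.rpow_le_rpow_of_exponent_ge ht0 ht1 (by linarith)
  have h4 : 0 < t ^ (s - 1) := Real.rpow_pos_of_pos ht0 _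
  nlinarith

theorem aux_hasDeriv (s m x : ℝ) (hx : 0 < x) :
    HasDerivAt (fun x : ℝ => ((1 + x) ^ s - 1) * x ^ (-s) + x ^ s - m * s * x⁻¹)
      (s * x ^ (-s - 1) * (1 + x ^ (2 * s) + m * x ^ (s - 1) - (1 + x) ^ (s - 1))) x := by
  have h1 : HasDerivAt (fun x : ℝ => (1 + x) ^ s) (1 * s * (1 + x) ^ (s - 1)) x :=
    ((hasDerivAt_id x).const_add 1).rpow_const (Or.inl (by simp; linarith))
  have h2 := Real.hasDerivAt_rpow_const (x := x) (p := -s) (Or.inl hx.ne')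
  have h3 := Real.hasDerivAt_rpow_const (x := x) (p := s) (Or.inl hx.ne')
  have h4 := (hasDerivAt_inv hx.ne').const_mul (m * s)
  refine ((((h1.sub_const 1).mul h2).add h3).sub h4).congr_deriv ?_
  have e1 : x ^ (-s) = x ^ (-s - 1) * x := by
    rw [← Real.rpow_add_one hx.ne']; ring_nf
  have e2 : (1 + x) ^ s = (1 + x) ^ (s - 1) * (1 + x) := by
    rw [← Real.rpow_add_one (by linarith)]; ring_nf
  have e3 : x ^ (s - 1) = x ^ (-s - 1) * x ^ (2 * s) := by
    rw [← Real.rpow_add hx]; ring_nf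
  have e4 : (x ^ 2)⁻¹ = x ^ (-s - 1) * x ^ (s - 1) := by
    rw [← Real.rpow_add hx, ← Real.rpow_natCast, ← Real.rpow_neg hx.le]
    congr 1; push_cast; ring
  rw [e4, e1, e2]
  linear_combination s * e3

theorem aux_key_s13 (s m k t : ℝ) (hm : 0 ≤ m) (hs : 1 + Real.logb 2 (m + 2) ≤ s)
    (ht0 : 0 < t) (htk : t ≤ k) (hk1 : k ≤ 1) :
    1 + (((1 + k) ^ s - 1) / k ^ s + k ^ s - t ^ s + m * s * (1 / t - 1 / k)) * t ^ s
      ≤ (1 + t) ^ s := by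
  have hs0 : 0 ≤ s := by
    have : 0 ≤ Real.logb 2 (m + 2) := Real.logb_nonneg (by norm_num) (by linarith)
    linarith
  have hk0 : 0 < k := by linarith
  have hanti : AntitoneOn
      (fun x : ℝ => ((1 + x) ^ s - 1) * x ^ (-s) + x ^ s - m * s * x⁻¹) (Set.Icc t k) := by
    apply antitoneOn_of_deriv_nonpos (convex_Icc t k)
    · intro x hx
      exact (aux_hasDeriv s m x (by linarith [hx.1])).continuousAt.continuousWithinAt
    · intro x hx
      rw [interior_Icc] at hx
      exact (aux_hasDeriv s m x (by linarith [hx.1])).differentiableAt.differentiableWithinAt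
    · intro x hx
      rw [interior_Icc] at hx
      have hx0 : 0 < x := by linarith [hx.1]
      rw [(aux_hasDeriv s m x hx0).deriv]
      apply mul_nonpos_of_nonneg_of_nonpos
      · positivity
      · linarith [aux_deriv_s13 s m x hm hs hx0 (by linarith [hx.2])]
  have h := hanti ⟨le_rfl, htk⟩ ⟨htk, le_rfl⟩ htk
  simp only [Real.rpow_neg hk0.le, Real.rpow_neg ht0.le] at h
  have hp : 0 < t ^ s := Real.rpow_pos_of_pos ht0 _
  have h' : ((1 + k) ^ s - 1) / k ^ s + k ^ s - t ^ s + m * s * (1 / t - 1 / k)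
      ≤ ((1 + t) ^ s - 1) / t ^ s := by
    simp only [div_eq_mul_inv, one_mul]
    linarith
  rw [le_div_iff₀ hp] at h'
  linarith

theorem aux_step (γ m k α a b c : ℝ) (hγ : 0 < γ) (hm : 0 ≤ m) (hk1 : k ≤ 1)
    (hk0 : 0 < k) (hα : (1 + Real.logb 2 (m + 2)) * γ ≤ α)
    (ha : 0 < a) (hb : 0 < b) (hc : 0 < c)
    (hmono : a ^ γ + b ^ γ ≤ c ^ γ) (hgrp : b ^ γ ≤ k * a ^ γ) :
    0 ≤ (((1 + k) ^ (α / γ) - 1) / k ^ (α / γ) + k ^ (α / γ) - b ^ α / a ^ α)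
          + m * α / γ * (a ^ γ / b ^ γ - 1 / k) ∧
    a ^ α + ((((1 + k) ^ (α / γ) - 1) / k ^ (α / γ) + k ^ (α / γ) - b ^ α / a ^ α)
          + m * α / γ * (a ^ γ / b ^ γ - 1 / k)) * b ^ α ≤ c ^ α := by
  have hs : 1 + Real.logb 2 (m + 2) ≤ α / γ := by rwa [le_div_iff₀ hγ]
  have hs0 : 0 ≤ α / γ := by
    have : 0 ≤ Real.logb 2 (m + 2) := Real.logb_nonneg (by norm_num) (by linarith)
    linarith
  have hpow : ∀ x : ℝ, 0 < x → x ^ α = (x ^ γ) ^ (α / γ) := by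
    intro x hx
    rw [← Real.rpow_mul hx.le]; congr 1; field_simp
  rw [hpow a ha, hpow b hb, hpow c hc, mul_div_assoc m α γ]
  have hA := Real.rpow_pos_of_pos ha γ
  have hB := Real.rpow_pos_of_pos hb γ
  generalize a ^ γ = A at *
  generalize b ^ γ = B at *
  generalize c ^ γ = C at *
  generalize α / γ = s at *
  obtain ⟨t, ht⟩ : ∃ t, t = B / A := ⟨_, rfl⟩
  have ht0 : 0 < t := by rw [ht]; positivity
  have htk : t ≤ k := by rw [ht, div_le_iff₀ hA]; exact hgrp
  have hBt : B = A * t := by rw [ht]; field_simp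
  have e1 : B ^ s / A ^ s = t ^ s := by rw [ht, Real.div_rpow hB.le hA.le]
  have e2 : A / B = 1 / t := by rw [ht]; field_simp
  have e3 : B ^ s = A ^ s * t ^ s := by rw [hBt, Real.mul_rpow hA.le ht0.le]
  have hAs := Real.rpow_pos_of_pos hA s
  rw [e1, e2, e3]
  constructor
  · have h1 : 0 ≤ ((1 + k) ^ s - 1) / k ^ s := by
      apply div_nonneg _ (by positivity)
      linarith [Real.one_le_rpow (show 1 ≤ 1 + k by linarith) hs0]
    have h2 : t ^ s ≤ k ^ s := Real.rpow_le_rpow ht0.le htk hs0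
    have h3 : 1 / k ≤ 1 / t := one_div_le_one_div_of_le ht0 htk
    have h4 : 0 ≤ m * s * (1 / t - 1 / k) := mul_nonneg (by positivity) (by linarith)
    linarith
  · have h := mul_le_mul_of_nonneg_left (aux_key_s13 s m k t hm hs ht0 htk hk1) hAs.le
    have h5 : A ^ s * (1 + t) ^ s ≤ C ^ s := by
      rw [← Real.mul_rpow hA.le (by linarith)]
      apply Real.rpow_le_rpow (by positivity) _ hs0
      linarith
    linarith

/-- Corollary 3.4: tighter α-th monogamy relation for N-partite states when
`k·e_i^γ ≥ f_{i+1}^γ` holds for all `i = 1, …, N-2`. Here `e i` plays the role of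
`E(ρ_{A B_i})` and `f i` that of `E(ρ_{A|B_i ⋯ B_{N-1}})`. -/
theorem tighter_monogamy_multipartite_all (γ m k α : ℝ) (N : ℕ) (e f : ℕ → ℝ)
    (hγ : 0 < γ) (hm : 0 ≤ m) (hk0 : 0 < k) (hk1 : k ≤ 1)
    (hα : (1 + Real.logb 2 (m + 2)) * γ ≤ α)
    (hN : 3 ≤ N)
    (hepos : ∀ i, 1 ≤ i → i ≤ N - 1 → 0 < e i)
    (hfpos : ∀ i, 1 ≤ i → i ≤ N - 1 → 0 < f i)
    (hlast : f (N - 1) = e (N - 1))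
    (hmono : ∀ i, 1 ≤ i → i ≤ N - 2 → f i ^ γ ≥ e i ^ γ + f (i + 1) ^ γ)
    (hgrp : ∀ i, 1 ≤ i → i ≤ N - 2 → k * e i ^ γ ≥ f (i + 1) ^ γ) :
    f 1 ^ α ≥
      e 1 ^ α
      + ∑ i ∈ Finset.Icc 1 (N - 2),
          (∏ j ∈ Finset.Icc 1 i,
            ((((1 + k) ^ (α / γ) - 1) / k ^ (α / γ) + k ^ (α / γ)
                - f (j + 1) ^ α / e j ^ α)
              + m * α / γ * (e j ^ γ / f (j + 1) ^ γ - 1 / k))) * e (i + 1) ^ α := by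
  obtain ⟨c, hc⟩ : ∃ c : ℕ → ℝ, c = fun j =>
    ((((1 + k) ^ (α / γ) - 1) / k ^ (α / γ) + k ^ (α / γ)
                - f (j + 1) ^ α / e j ^ α)
              + m * α / γ * (e j ^ γ / f (j + 1) ^ γ - 1 / k)) := ⟨_, rfl⟩
  have hstep : ∀ j, 1 ≤ j → j ≤ N - 2 →
      0 ≤ c j ∧ e j ^ α + c j * f (j + 1) ^ α ≤ f j ^ α := by
    intro j h1 h2
    rw [hc]
    exact aux_step γ m k α (e j) (f (j + 1)) (f j) hγ hm hk1 hk0 hα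
      (hepos j h1 (by omega)) (hfpos (j + 1) (by omega) (by omega))
      (hfpos j h1 (by omega)) (hmono j h1 h2) (hgrp j h1 h2)
  have hind : ∀ n, n ≤ N - 2 →
      ∑ i ∈ Finset.range n, (∏ j ∈ Finset.Icc 1 i, c j) * e (i + 1) ^ α
        + (∏ j ∈ Finset.Icc 1 n, c j) * f (n + 1) ^ α ≤ f 1 ^ α := by
    intro n
    induction n with
    | zero => intro _; simp
    | succ n ih =>
      intro hn
      have h := ih (by omega)
      rw [Finset.sum_range_succ, Finset.prod_Icc_succ_top (by omega)]
      have hP : 0 ≤ ∏ j ∈ Finset.Icc 1 n, c j := by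
        apply Finset.prod_nonneg
        intro j hj
        rw [Finset.mem_Icc] at hj
        exact (hstep j hj.1 (by omega)).1
      have h2 := mul_le_mul_of_nonneg_left (hstep (n + 1) (by omega) hn).2 hP
      linarith
  have h := hind (N - 2) le_rfl
  rw [show N - 2 + 1 = N - 1 by omega, hlast, show N - 1 = N - 2 + 1 by omega,
    ← Finset.sum_range_succ (fun i => (∏ j ∈ Finset.Icc 1 i, c j) * e (i + 1) ^ α),
    Finset.sum_range_succ'] at h
  have hre : ∑ i ∈ Finset.Icc 1 (N - 2), (∏ j ∈ Finset.Icc 1 i, c j) * e (i + 1) ^ α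
      = ∑ i ∈ Finset.range (N - 2),
        (∏ j ∈ Finset.Icc 1 (i + 1), c j) * e (i + 1 + 1) ^ α := by
    rw [Finset.range_eq_Ico, Finset.sum_Ico_add'
      (fun i => (∏ j ∈ Finset.Icc 1 i, c j) * e (i + 1) ^ α) 0 (N - 2) 1]
    rfl
  rw [hc] at hre h
  rw [hre]
  simp only [zero_add] at h
  simp at h ⊢
  linarith
end
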